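/- Fix an integer r ≥ 2. There exists a constant c_r > 0 such that the following holds: if H is an (r+1)-uniform hypergraph on n vertices whose maximum r-degree Δ_r satisfies 1 ≤ Δ_r < n/(log n)^{3r^2}, then the independence number of H satisfies α(H) ≥ c_r · ((n/Δ_r) · log(n/Δ_r))^{1/r}. -/

import Mathlib

open Finset

/-- independent subsets of `U` -/
def KMVInd {V : Type} [DecidableEq V] (H : Finset (Finset V)) (U : Finset V) : Finset (Finset V) :=
  U.powerset.filter fun S => ∀ e ∈ H, ¬ e ⊆ S

/-- number of edges `e` through `v` with `e \ v` inside `W` -/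
def KMVD {V : Type} [DecidableEq V] (H : Finset (Finset V)) (v : V) (W : Finset V) : ℕ :=
  (H.filter fun e => v ∈ e ∧ e.erase v ⊆ W).card

/-- nothing bad happens at `v` inside `U` -/
def KMVGood {V : Type} [DecidableEq V] (H : Finset (Finset V)) (v : V) (U : Finset V) : Prop :=
  (∀ e₁ ∈ H, ∀ e₂ ∈ H, v ∈ e₁ → v ∈ e₂ → e₁.erase v ⊆ U → e₂.erase v ⊆ U → e₁ ≠ e₂ →
    Disjoint (e₁.erase v) (e₂.erase v)) ∧
  (∀ e₁ ∈ H, ∀ e₂ ∈ H, v ∈ e₁ → v ∈ e₂ → e₁.erase v ⊆ U → e₂.erase v ⊆ U → e₁ ≠ e₂ →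
    ∀ f ∈ H, f ⊆ U → Disjoint f (e₁.erase v) ∨ Disjoint f (e₂.erase v))

theorem kmv_local {V : Type} [DecidableEq V] (H : Finset (Finset V)) (v : V) (U : Finset V)
    (hv : v ∉ U) (hne : ∀ e ∈ H, v ∈ e → (e.erase v).Nonempty) (hg : KMVGood H v U)
    (q : ℝ) (hq : 0 < q) :
    Real.log q * ((KMVInd H U).card : ℝ) ≤
      2 * ∑ W ∈ KMVInd H U, (KMVD H v W : ℝ) +
      q * (((KMVInd H U).filter fun W => KMVD H v W = 0).card : ℝ) := by
  classical
  obtain ⟨g1, g2⟩ := hg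
  set I := KMVInd H U with hI
  set L := H.filter fun e => v ∈ e ∧ e.erase v ⊆ U with hL
  have memI : ∀ W, W ∈ I ↔ W ⊆ U ∧ ∀ e ∈ H, ¬ e ⊆ W := by
    intro W; simp [hI, KMVInd]
  have hy : ∃ y : Finset V → V, ∀ e ∈ L, y e ∈ e.erase v := by
    have : ∀ e : Finset V, ∃ z : V, e ∈ L → z ∈ e.erase v := by
      intro e
      by_cases h : e ∈ L
      · obtain ⟨z, hz⟩ := hne e (mem_filter.1 h).1 (mem_filter.1 h).2.1
        exact ⟨z, fun _ => hz⟩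
      · exact ⟨v, fun h' => absurd h' h⟩
    choose y hy using this
    exact ⟨y, hy⟩
  obtain ⟨y, hy⟩ := hy
  have hL' : ∀ e ∈ L, e ∈ H ∧ v ∈ e ∧ e.erase v ⊆ U := by
    intro e he; simpa [hL] using he
  have hdisj : ∀ e₁ ∈ L, ∀ e₂ ∈ L, e₁ ≠ e₂ → Disjoint (e₁.erase v) (e₂.erase v) := by
    intro e₁ h₁ e₂ h₂ hn
    obtain ⟨a, b, c⟩ := hL' _ h₁
    obtain ⟨a', b', c'⟩ := hL' _ h₂
    exact g1 _ a _ a' b b' c c' hn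
  have htwo : ∀ e₁ ∈ L, ∀ e₂ ∈ L, e₁ ≠ e₂ → ∀ f ∈ H, f ⊆ U → y e₁ ∈ f → y e₂ ∈ f → False := by
    intro e₁ h₁ e₂ h₂ hn f hf hfU m1 m2
    obtain ⟨a, b, c⟩ := hL' _ h₁
    obtain ⟨a', b', c'⟩ := hL' _ h₂
    rcases g2 _ a _ a' b b' c c' hn f hf hfU with h | h
    · exact Finset.disjoint_left.1 h m1 (hy _ h₁)
    · exact Finset.disjoint_left.1 h m2 (hy _ h₂)
  set B : Finset V → Finset (Finset V) := fun W =>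
    L.filter fun e => (e.erase v).erase (y e) ⊆ W ∧ ∀ f ∈ H, ¬ f ⊆ insert (y e) W with hB
  set T : Finset V → Finset (Finset V) := fun W => L.filter fun e => e.erase v ⊆ W with hT
  have hTD : ∀ W ∈ I, KMVD H v W = (T W).card := by
    intro W hW
    have hWU := ((memI W).1 hW).1
    unfold KMVD
    congr 1
    ext e
    simp only [hT, hL, mem_filter]
    constructor
    · rintro ⟨a, b, c⟩; exact ⟨⟨a, b, c.trans hWU⟩, c⟩
    · rintro ⟨⟨a, b, _⟩, c⟩; exact ⟨a, b, c⟩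
  -- first inequality
  have hsum : ∑ W ∈ I, ((B W).card : ℝ) ≤ 2 * ∑ W ∈ I, (KMVD H v W : ℝ) := by
    have e1 : ∑ W ∈ I, (B W).card = ∑ e ∈ L, (I.filter fun W => e ∈ B W).card := by
      have hBL : ∀ W ∈ I, (B W).card = (L.filter fun e => e ∈ B W).card := by
        intro W _
        congr 1
        ext e; simp only [hB, mem_filter]; tauto
      rw [Finset.sum_congr rfl hBL]
      simp only [Finset.card_eq_sum_ones, Finset.sum_filter]
      rw [Finset.sum_comm]
    have e2 : ∑ W ∈ I, KMVD H v W = ∑ e ∈ L, (I.filter fun W => e.erase v ⊆ W).card := by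
      rw [Finset.sum_congr rfl hTD]
      simp only [hT, Finset.card_eq_sum_ones, Finset.sum_filter]
      rw [Finset.sum_comm]
    have e3 : ∀ e ∈ L, (I.filter fun W => e ∈ B W).card
        ≤ 2 * (I.filter fun W => e.erase v ⊆ W).card := by
      intro e he
      have hye := hy e he
      rw [two_mul, ← Finset.card_filter_add_card_filter_not (s := I.filter fun W => e ∈ B W)
        (fun W => y e ∈ W)]
      apply add_le_add
      · apply card_le_card
        intro W hW
        simp only [hB, mem_filter] at hW ⊢
        refine ⟨hW.1.1, ?_⟩
        intro z hz
        by_cases hzy : z = y e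
        · rw [hzy]; exact hW.2
        · exact hW.1.2.2.1 (mem_erase.2 ⟨hzy, hz⟩)
      · apply Finset.card_le_card_of_injOn (fun W => insert (y e) W)
        · intro W hW
          simp only [hB, coe_filter, Set.mem_ofPred_eq, mem_filter] at hW ⊢
          refine ⟨(memI _).2 ⟨?_, hW.1.2.2.2⟩, ?_⟩
          · apply insert_subset
            · exact (hL' e he).2.2 hye
            · exact ((memI _).1 hW.1.1).1
          · intro z hz
            by_cases hzy : z = y e
            · rw [hzy]; exact mem_insert_self _ _
            · exact mem_insert_of_mem (hW.1.2.2.1 (mem_erase.2 ⟨hzy, hz⟩))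
        · intro W hW W' hW' h
          simp only [coe_filter, Set.mem_ofPred_eq] at hW hW'
          have := congrArg (fun s => s.erase (y e)) h
          simpa [erase_insert hW.2, erase_insert hW'.2] using this
    have : ∑ W ∈ I, (B W).card ≤ 2 * ∑ W ∈ I, KMVD H v W := by
      rw [e1, e2, mul_sum]
      exact sum_le_sum e3
    exact_mod_cast this
  -- second inequality
  have hsec : ∑ W ∈ I, ((2:ℝ)⁻¹) ^ (B W).card ≤
      ((I.filter fun W => KMVD H v W = 0).card : ℝ) := by
    set g : Finset V → Finset V := fun W => W \ (T W).image y with hgdef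
    have gsub : ∀ W, g W ⊆ W := fun W => sdiff_subset
    have gmem : ∀ W ∈ I, g W ∈ I.filter fun W => KMVD H v W = 0 := by
      intro W hW
      have hgI : g W ∈ I := by
        rw [memI] at hW ⊢
        exact ⟨(gsub W).trans hW.1, fun e he h => hW.2 e he (h.trans (gsub W))⟩
      rw [mem_filter]
      refine ⟨hgI, ?_⟩
      rw [hTD _ hgI, card_eq_zero, eq_empty_iff_forall_notMem]
      intro e he
      simp only [hT, mem_filter] at he
      have h1 : e ∈ T W := by
        simp only [hT, mem_filter]; exact ⟨he.1, he.2.trans (gsub W)⟩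
      have h2 := he.2 (hy e he.1)
      exact (mem_sdiff.1 h2).2 (mem_image_of_mem y h1)
    rw [← Finset.sum_fiberwise_of_maps_to gmem, Finset.card_eq_sum_ones]
    push_cast
    apply sum_le_sum
    intro W0 hW0
    have hrec : ∀ W ∈ I, W = g W ∪ (T W).image y := by
      intro W hW
      simp only [hgdef]
      rw [sdiff_union_of_subset]
      intro z hz
      obtain ⟨e, he, rfl⟩ := mem_image.1 hz
      simp only [hT, mem_filter] at he
      exact he.2 (hy e he.1)
    have hTB : ∀ W ∈ I, T W ⊆ B (g W) := by
      intro W hW e he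
      have he' := he
      simp only [hT, mem_filter] at he
      simp only [hB, mem_filter]
      refine ⟨he.1, ?_, ?_⟩
      · intro z hz
        have hz2 := mem_erase.1 hz
        apply mem_sdiff.2
        refine ⟨he.2 hz2.2, ?_⟩
        intro him
        obtain ⟨e', he2, hz3⟩ := mem_image.1 him
        have he3 : e' ∈ L := (mem_filter.1 he2).1
        have hnn : e ≠ e' := by
          rintro rfl; exact hz2.1 hz3.symm
        have := hdisj e he.1 e' he3 hnn
        exact Finset.disjoint_left.1 this hz2.2 (hz3 ▸ hy e' he3)
      · intro f hf hfs
        apply ((memI W).1 hW).2 f hf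
        refine hfs.trans (insert_subset (he.2 (hy e he.1)) (gsub W))
    have hBB : ∀ W ∈ I, B (g W) ⊆ B W := by
      intro W hW e he
      simp only [hB, mem_filter] at he ⊢
      refine ⟨he.1, he.2.1.trans (gsub W), ?_⟩
      intro f hf hfs
      have hWU := ((memI W).1 hW).1
      have hfU : f ⊆ U := hfs.trans (insert_subset ((hL' e he.1).2.2 (hy e he.1)) hWU)
      by_cases hyf : y e ∈ f
      · apply he.2.2 f hf
        intro z hz
        have := hfs hz
        rw [mem_insert] at this ⊢
        rcases this with h | h
        · exact Or.inl h
        · by_cases hzi : z ∈ (T W).image y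
          · left
            obtain ⟨e', he', rfl⟩ := mem_image.1 hzi
            have he3 : e' ∈ L := (mem_filter.1 he').1
            by_contra hcon
            have hnn : e ≠ e' := by
              rintro rfl; exact hcon rfl
            exact htwo e he.1 e' he3 hnn f hf hfU hyf hz
          · right; exact mem_sdiff.2 ⟨h, hzi⟩
      · apply ((memI W).1 hW).2 f hf
        intro z hz
        have := hfs hz
        rw [mem_insert] at this
        rcases this with h | h
        · exact absurd (h ▸ hz) hyf
        · exact h
    calc ∑ W ∈ I with g W = W0, ((2:ℝ)⁻¹) ^ (B W).card
        ≤ ∑ W ∈ I with g W = W0, ((2:ℝ)⁻¹) ^ (B W0).card := by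
          apply sum_le_sum
          intro W hW
          rw [mem_filter] at hW
          apply pow_le_pow_of_le_one (by norm_num) (by norm_num)
          rw [← hW.2]
          exact card_le_card (hBB W hW.1)
      _ = ((I.filter fun W => g W = W0).card : ℝ) * ((2:ℝ)⁻¹) ^ (B W0).card := by
          rw [sum_const, nsmul_eq_mul]
      _ ≤ (2:ℝ) ^ (B W0).card * ((2:ℝ)⁻¹) ^ (B W0).card := by
          apply mul_le_mul_of_nonneg_right _ (by positivity)
          have : (I.filter fun W => g W = W0).card ≤ (B W0).powerset.card := by
            apply card_le_card_of_injOn T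
            · intro W hW
              simp only [coe_filter, Set.mem_ofPred_eq] at hW
              simp only [coe_powerset, Set.mem_preimage, Set.mem_powerset_iff, coe_subset]
              rw [← hW.2]; exact hTB W hW.1
            · intro W hW W' hW' h
              simp only [coe_filter, Set.mem_ofPred_eq] at hW hW'
              rw [hrec W hW.1, hrec W' hW'.1, hW.2, hW'.2, h]
          rw [card_powerset] at this
          exact_mod_cast this
      _ = 1 := by rw [← mul_pow]; norm_num
  have hpt : ∀ x : ℕ, Real.log q ≤ x + q * ((2:ℝ)⁻¹) ^ x := by
    intro x
    have h1 : Real.exp (-(x:ℝ)) ≤ ((2:ℝ)⁻¹) ^ x := by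
      rw [Real.exp_neg, inv_pow]
      apply inv_anti₀ (by positivity)
      have : Real.exp (x:ℝ) = (Real.exp 1) ^ x := by rw [← Real.exp_nat_mul, mul_one]
      rw [this]
      apply pow_le_pow_left₀ (by norm_num)
      have := Real.add_one_le_exp (1:ℝ)
      linarith
    have h2 := Real.add_one_le_exp (Real.log q - x)
    rw [sub_eq_add_neg, Real.exp_add, Real.exp_log hq] at h2
    have h3 := mul_le_mul_of_nonneg_left h1 hq.le
    linarith
  calc Real.log q * (I.card : ℝ) = ∑ W ∈ I, Real.log q := by
        rw [sum_const, nsmul_eq_mul, mul_comm]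
    _ ≤ ∑ W ∈ I, (((B W).card : ℝ) + q * ((2:ℝ)⁻¹) ^ (B W).card) :=
        sum_le_sum fun W _ => hpt _
    _ = ∑ W ∈ I, ((B W).card : ℝ) + q * ∑ W ∈ I, ((2:ℝ)⁻¹) ^ (B W).card := by
        rw [sum_add_distrib, mul_sum]
    _ ≤ _ := add_le_add hsum (mul_le_mul_of_nonneg_left hsec hq.le)

theorem kmv_empty_mem {V : Type} [DecidableEq V] (H : Finset (Finset V)) (U : Finset V)
    (hne : ∀ e ∈ H, e.Nonempty) : ∅ ∈ KMVInd H U := by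
  simp only [KMVInd, mem_filter, empty_mem_powerset, true_and]
  intro e he h
  exact (hne e he).ne_empty (subset_empty.1 h)

/-- average of `t 1[v ∈ W] + D` over the independent sets inside `U` -/
noncomputable def KMVF {V : Type} [DecidableEq V] (H : Finset (Finset V)) (t : ℝ) (v : V)
    (U : Finset V) : ℝ :=
  (∑ W ∈ KMVInd H U, (t * (if v ∈ W then 1 else 0) + (KMVD H v W : ℝ))) / ((KMVInd H U).card : ℝ)

theorem kmvF_nonneg {V : Type} [DecidableEq V] (H : Finset (Finset V)) (t : ℝ) (ht : 0 ≤ t) (v : V)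
    (U : Finset V) : 0 ≤ KMVF H t v U := by
  unfold KMVF
  apply div_nonneg _ (Nat.cast_nonneg _)
  apply sum_nonneg
  intro W _
  split_ifs <;> positivity

theorem kmv_local2 {V : Type} [DecidableEq V] (H : Finset (Finset V)) (v : V) (U : Finset V)
    (hv : v ∉ U) (hne : ∀ e ∈ H, v ∈ e → (e.erase v).Nonempty) (hne' : ∀ e ∈ H, e.Nonempty)
    (hg : KMVGood H v U) (p t : ℝ) (hp : 0 < p) (hp2 : p ≤ 1 / 2) (ht : 0 < t) :
    Real.log (p * t) / 4 ≤ (1 - p) * KMVF H t v U + p * KMVF H t v (insert v U) := by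
  classical
  have key := kmv_local H v U hv hne hg (p * t) (by positivity)
  have memI : ∀ U W, W ∈ KMVInd H U ↔ W ⊆ U ∧ ∀ e ∈ H, ¬ e ⊆ W := by
    intro U W; simp [KMVInd]
  set I := KMVInd H U with hI
  set J := KMVInd H (insert v U) with hJ
  set Z := I.filter fun W => KMVD H v W = 0 with hZ
  have hIpos : (0:ℝ) < I.card := by
    exact_mod_cast card_pos.2 ⟨∅, kmv_empty_mem H U hne'⟩
  have hJpos : (0:ℝ) < J.card := by
    exact_mod_cast card_pos.2 ⟨∅, kmv_empty_mem H (insert v U) hne'⟩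
  have hJI : (J.card : ℝ) ≤ 2 * I.card := by
    have : J.card ≤ 2 * I.card := by
      rw [two_mul, ← Finset.card_filter_add_card_filter_not (s := J) (fun W => v ∈ W)]
      apply add_le_add
      · apply card_le_card_of_injOn (fun W => W.erase v)
        · intro W hW
          simp only [coe_filter, Set.mem_ofPred_eq] at hW
          obtain ⟨h1, h2⟩ := (memI _ _).1 hW.1
          refine (memI _ _).2 ⟨?_, fun e he h => h2 e he (h.trans (erase_subset _ _))⟩
          intro z hz
          have hz' := mem_erase.1 hz
          exact (mem_insert.1 (h1 hz'.2)).resolve_left hz'.1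
        · intro W hW W' hW' h
          simp only [coe_filter, Set.mem_ofPred_eq] at hW hW'
          have := congrArg (fun s => insert v s) h
          simpa [insert_erase hW.2, insert_erase hW'.2] using this
      · apply card_le_card
        intro W hW
        rw [mem_filter] at hW
        obtain ⟨h1, h2⟩ := (memI _ _).1 hW.1
        refine (memI _ _).2 ⟨?_, h2⟩
        intro z hz
        refine (mem_insert.1 (h1 hz)).resolve_left ?_
        rintro rfl; exact hW.2 hz
    exact_mod_cast this
  have hZJ : (Z.card : ℝ) ≤ ((J.filter fun W => v ∈ W).card : ℝ) := by
    have : Z.card ≤ (J.filter fun W => v ∈ W).card := by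
      apply card_le_card_of_injOn (fun W => insert v W)
      · intro W hW
        simp only [hZ, coe_filter, Set.mem_ofPred_eq] at hW ⊢
        obtain ⟨h1, h2⟩ := (memI _ _).1 hW.1
        refine ⟨(memI _ _).2 ⟨insert_subset_insert _ h1, ?_⟩, mem_insert_self _ _⟩
        intro e he hs
        have h3 := hW.2
        unfold KMVD at h3
        rw [card_eq_zero, eq_empty_iff_forall_notMem] at h3
        by_cases hve : v ∈ e
        · apply h3 e
          rw [mem_filter]
          refine ⟨he, hve, ?_⟩
          intro z hz
          have hz' := mem_erase.1 hz
          exact (mem_insert.1 (hs hz'.2)).resolve_left hz'.1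
        · apply h2 e he
          intro z hz
          refine (mem_insert.1 (hs hz)).resolve_left ?_
          rintro rfl; exact hve hz
      · intro W hW W' hW' h
        simp only [hZ, coe_filter, Set.mem_ofPred_eq] at hW hW'
        have a1 : v ∉ W := fun h => hv (((memI _ _).1 hW.1).1 h)
        have a2 : v ∉ W' := fun h => hv (((memI _ _).1 hW'.1).1 h)
        have := congrArg (fun s => s.erase v) h
        simpa [erase_insert a1, erase_insert a2] using this
    exact_mod_cast this
  have hF1 : (∑ W ∈ I, (KMVD H v W : ℝ)) / I.card ≤ KMVF H t v U := by
    unfold KMVF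
    apply div_le_div_of_nonneg_right _ hIpos.le
    apply sum_le_sum
    intro W _
    split_ifs <;> linarith
  have hF2 : t * (Z.card : ℝ) / (2 * I.card) ≤ KMVF H t v (insert v U) := by
    unfold KMVF
    rw [← hJ]
    apply div_le_div₀ _ _ hJpos hJI
    · apply sum_nonneg
      intro W _
      split_ifs <;> positivity
    · calc t * (Z.card : ℝ) ≤ t * ((J.filter fun W => v ∈ W).card : ℝ) :=
            mul_le_mul_of_nonneg_left hZJ ht.le
        _ = ∑ W ∈ J, t * (if v ∈ W then 1 else 0) := by
            rw [← mul_sum, Finset.sum_boole]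
        _ ≤ _ := by
            apply sum_le_sum
            intro W _
            have : (0:ℝ) ≤ KMVD H v W := Nat.cast_nonneg _
            linarith
  have hS : 0 ≤ ∑ W ∈ I, (KMVD H v W : ℝ) := sum_nonneg fun _ _ => Nat.cast_nonneg _
  generalize (∑ W ∈ I, (KMVD H v W : ℝ)) = S at *
  generalize KMVF H t v U = F1 at *
  generalize KMVF H t v (insert v U) = F2 at *
  generalize (I.card : ℝ) = i at *
  generalize hz : (Z.card : ℝ) = z at *
  have hz0 : 0 ≤ z := hz ▸ Nat.cast_nonneg _
  clear_value I J Z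
  clear hZJ hJI hJpos memI hg hne hne' hI hJ hZ hz
  have h1 : (1/2) * (S / i) ≤ (1 - p) * F1 :=
    mul_le_mul (by linarith) hF1 (div_nonneg hS hIpos.le) (by linarith)
  have h2 := mul_le_mul_of_nonneg_left hF2 hp.le
  have h3 : Real.log (p * t) / 4 ≤ (1/2) * (S / i) + p * (t * z / (2 * i)) := by
    have : (1/2) * (S / i) + p * (t * z / (2 * i)) = (2 * S + 2 * (p * t * z)) / (4 * i) := by
      field_simp; ring
    rw [this, div_le_div_iff₀ (by norm_num) (by positivity)]
    have : 0 ≤ p * t * z := by positivity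
    linarith
  linarith

theorem kmv_sum_D {V : Type} [Fintype V] [DecidableEq V] (H : Finset (Finset V)) (r Δ : ℕ)
    (hu : ∀ e ∈ H, e.card = r + 1)
    (hΔ : ∀ R : Finset V, R.card = r → (H.filter fun e => R ⊆ e).card ≤ Δ) (W : Finset V) :
    ∑ v, KMVD H v W ≤ Δ * W.card ^ r := by
  classical
  have h1 : ∑ v, KMVD H v W =
      ((univ : Finset V).sigma fun v => H.filter fun e => v ∈ e ∧ e.erase v ⊆ W).card := by
    rw [card_sigma]; rfl
  have h2 : ((univ : Finset V).sigma fun v => H.filter fun e => v ∈ e ∧ e.erase v ⊆ W).card ≤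
      ((W.powersetCard r).sigma fun R => H.filter fun e => R ⊆ e).card := by
    apply card_le_card_of_injOn (fun x => ⟨x.2.erase x.1, x.2⟩)
    · rintro ⟨v, e⟩ hx
      simp only [coe_sigma, Set.mem_sigma_iff, coe_univ, Set.mem_univ, true_and, mem_coe,
        mem_filter, mem_powersetCard] at hx ⊢
      refine ⟨⟨hx.2.2, ?_⟩, hx.1, erase_subset _ _⟩
      rw [card_erase_of_mem hx.2.1, hu e hx.1]; rfl
    · rintro ⟨v, e⟩ hx ⟨v', e'⟩ hx' h
      simp only [coe_sigma, Set.mem_sigma_iff, coe_univ, Set.mem_univ, true_and, mem_coe,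
        mem_filter] at hx hx'
      simp only [Sigma.mk.injEq, heq_eq_eq] at h
      obtain ⟨h, rfl⟩ := h
      have : v = v' := by
        by_contra hne
        have : v' ∈ e.erase v := mem_erase.2 ⟨fun h => hne h.symm, hx'.2.1⟩
        rw [h] at this
        simp at this
      rw [this]
  rw [h1]
  refine h2.trans ?_
  rw [card_sigma]
  calc _ ≤ ∑ R ∈ W.powersetCard r, Δ :=
        sum_le_sum fun R hR => hΔ R (mem_powersetCard.1 hR).2
    _ = Δ * W.card.choose r := by
        rw [sum_const, card_powersetCard, smul_eq_mul, mul_comm]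
    _ ≤ _ := Nat.mul_le_mul_left _ (Nat.choose_le_pow _ _)

theorem kmv_prob {V : Type} [DecidableEq V] (S T : Finset V) (hT : T ⊆ S) (p : ℝ) :
    ∑ U ∈ S.powerset, (if T ⊆ U then p ^ U.card * (1 - p) ^ (S.card - U.card) else 0)
      = p ^ T.card := by
  classical
  rw [← sum_filter]
  have h := Finset.sum_pow_mul_eq_add_pow p (1 - p) (S \ T)
  have e : ∑ U ∈ S.powerset with T ⊆ U, p ^ U.card * (1 - p) ^ (S.card - U.card) =
      ∑ U ∈ (S \ T).powerset, p ^ T.card * (p ^ U.card * (1 - p) ^ ((S \ T).card - U.card)) := by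
    apply Finset.sum_bij' (fun U _ => U \ T) (fun U _ => U ∪ T)
    · intro U hU
      simp only [mem_filter, mem_powerset] at hU ⊢
      exact sdiff_subset_sdiff hU.1 (Subset.refl _)
    · intro U hU
      simp only [mem_filter, mem_powerset] at hU ⊢
      exact ⟨union_subset (hU.trans sdiff_subset) hT, subset_union_right⟩
    · intro U hU
      simp only [mem_filter, mem_powerset] at hU
      exact sdiff_union_of_subset hU.2
    · intro U hU
      simp only [mem_powerset] at hU
      apply union_sdiff_cancel_right
      exact disjoint_left.2 fun z hz hz' => (mem_sdiff.1 (hU hz)).2 hz'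
    · intro U hU
      simp only [mem_filter, mem_powerset] at hU
      have h1 := card_sdiff_of_subset hU.2
      have h2 := card_sdiff_of_subset hT
      have h3 := card_le_card hU.1
      have h4 := card_le_card hU.2
      rw [← mul_assoc, ← pow_add, h1, h2]
      congr 2 <;> omega
  rw [e, ← mul_sum, h]
  simp

theorem kmv_codeg {V : Type} [Fintype V] [DecidableEq V] (H : Finset (Finset V)) (r Δ : ℕ)
    (hu : ∀ e ∈ H, e.card = r + 1)
    (hΔ : ∀ R : Finset V, R.card = r → (H.filter fun e => R ⊆ e).card ≤ Δ) :
    ∀ k : ℕ, ∀ S : Finset V, S.card + k = r →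
      (H.filter fun e => S ⊆ e).card ≤ Fintype.card V ^ k * Δ := by
  classical
  intro k
  induction k with
  | zero => intro S hS; simpa using hΔ S (by simpa using hS)
  | succ k ih =>
    intro S hS
    have hsub : (H.filter fun e => S ⊆ e) ⊆
        (univ \ S).biUnion fun u => H.filter fun e => insert u S ⊆ e := by
      intro e he
      rw [mem_filter] at he
      have hc : S.card < e.card := by rw [hu e he.1]; omega
      obtain ⟨u, hu1, hu2⟩ := exists_mem_notMem_of_card_lt_card hc
      rw [mem_biUnion]
      exact ⟨u, by simpa using hu2, mem_filter.2 ⟨he.1, insert_subset hu1 he.2⟩⟩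
    refine (card_le_card hsub).trans (card_biUnion_le.trans ?_)
    calc _ ≤ ∑ u ∈ univ \ S, Fintype.card V ^ k * Δ := by
          apply sum_le_sum
          intro u hu'
          apply ih
          rw [card_insert_of_notMem (by simpa using hu')]
          omega
      _ ≤ _ := by
          rw [sum_const, smul_eq_mul, pow_succ']
          rw [mul_assoc]
          exact Nat.mul_le_mul_right _ (card_le_univ _)

theorem kmv_ext {V : Type} [Fintype V] [DecidableEq V] (H : Finset (Finset V)) (r Δ : ℕ)
    (hu : ∀ e ∈ H, e.card = r + 1)
    (hΔ : ∀ R : Finset V, R.card = r → (H.filter fun e => R ⊆ e).card ≤ Δ)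
    (p m τ : ℝ) (hp : 0 ≤ p) (hm : 1 ≤ m) (hpm : p * Fintype.card V = m)
    (hτ : τ * Fintype.card V = Δ) (X : Finset V) (j N : ℕ) (hX : X.card ≤ N) :
    ∑ f ∈ H with (j ≤ (f ∩ X).card ∧ (f ∩ X).card ≤ r), p ^ (f \ X).card
      ≤ 2 ^ N * (m ^ (r + 1 - j) * τ) := by
  classical
  have hn0 : (0:ℝ) < Fintype.card V := by
    rcases Nat.eq_zero_or_pos (Fintype.card V) with h | h
    · rw [h] at hpm; simp at hpm; linarith
    · exact_mod_cast h
  have hτ0 : 0 ≤ τ := by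
    by_contra h
    push Not at h
    have : τ * Fintype.card V < 0 := mul_neg_of_neg_of_pos h hn0
    rw [hτ] at this
    exact absurd this (not_lt.2 (Nat.cast_nonneg _))
  set P := X.powerset.filter fun J => j ≤ J.card ∧ J.card ≤ r with hP
  have maps : ∀ f ∈ H.filter (fun f => j ≤ (f ∩ X).card ∧ (f ∩ X).card ≤ r), f ∩ X ∈ P := by
    intro f hf
    rw [mem_filter] at hf
    exact mem_filter.2 ⟨mem_powerset.2 inter_subset_right, hf.2⟩
  rw [← sum_fiberwise_of_maps_to maps]
  have each : ∀ J ∈ P, ∑ f ∈ H.filter (fun f => j ≤ (f ∩ X).card ∧ (f ∩ X).card ≤ r) with f ∩ X = J,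
      p ^ (f \ X).card ≤ m ^ (r + 1 - j) * τ := by
    intro J hJ
    rw [hP, mem_filter] at hJ
    obtain ⟨-, hj1, hj2⟩ := hJ
    calc _ ≤ ∑ f ∈ H with J ⊆ f, p ^ (r + 1 - J.card) := by
          refine (sum_le_sum_of_subset_of_nonneg (t := H.filter fun f => J ⊆ f ∧ f ∩ X = J) ?_
            ?_).trans ?_
          · intro f hf
            simp only [mem_filter] at hf ⊢
            exact ⟨hf.1.1, hf.2 ▸ inter_subset_left, hf.2⟩
          · intros; positivity
          · refine (sum_le_sum (g := fun _ => p ^ (r + 1 - J.card)) ?_).trans ?_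
            · intro f hf
              rw [mem_filter] at hf
              have := card_sdiff_add_card_inter f X
              rw [hf.2.2, hu f hf.1] at this
              have h2 : (f \ X).card = r + 1 - J.card := by omega
              rw [h2]
            · apply sum_le_sum_of_subset_of_nonneg
              · intro f hf
                simp only [mem_filter] at hf ⊢
                exact ⟨hf.1, hf.2.1⟩
              · intros; positivity
      _ = ((H.filter fun f => J ⊆ f).card : ℝ) * p ^ (r + 1 - J.card) := by
          rw [sum_const, nsmul_eq_mul]
      _ ≤ ((Fintype.card V : ℝ) ^ (r - J.card) * Δ) * p ^ (r + 1 - J.card) := by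
          apply mul_le_mul_of_nonneg_right _ (by positivity)
          exact_mod_cast kmv_codeg H r Δ hu hΔ (r - J.card) J (by omega)
      _ = m ^ (r + 1 - J.card) * τ := by
          have : r + 1 - J.card = (r - J.card) + 1 := by omega
          rw [← hτ, ← hpm, this, mul_pow]
          ring
      _ ≤ m ^ (r + 1 - j) * τ := by
          apply mul_le_mul_of_nonneg_right _ hτ0
          exact pow_le_pow_right₀ hm (by omega)
  refine (sum_le_sum each).trans ?_
  rw [sum_const, nsmul_eq_mul]
  apply mul_le_mul_of_nonneg_right _ (by positivity)
  have h1 : P.card ≤ 2 ^ X.card := by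
    rw [← card_powerset]; exact card_filter_le _ _
  have h2 : 2 ^ X.card ≤ 2 ^ N := Nat.pow_le_pow_right (by norm_num) hX
  exact_mod_cast h1.trans h2

theorem kmv_notGood {V : Type} [DecidableEq V] (H : Finset (Finset V)) (r : ℕ) (hr : 2 ≤ r)
    (hu : ∀ e ∈ H, e.card = r + 1) (v : V) (U : Finset V) (hv : v ∉ U) (hb : ¬ KMVGood H v U) :
    (∃ e₁ ∈ H, ∃ e₂ ∈ H, v ∈ e₁ ∧ (2 ≤ (e₂ ∩ e₁).card ∧ (e₂ ∩ e₁).card ≤ r) ∧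
      (e₁ ∪ e₂).erase v ⊆ U) ∨
    (∃ e₁ ∈ H, ∃ f ∈ H, ∃ e₂ ∈ H, v ∈ e₁ ∧ (1 ≤ (f ∩ e₁).card ∧ (f ∩ e₁).card ≤ r) ∧
      (2 ≤ (e₂ ∩ (e₁ ∪ f)).card ∧ (e₂ ∩ (e₁ ∪ f)).card ≤ r) ∧ (e₁ ∪ f ∪ e₂).erase v ⊆ U) := by
  classical
  by_cases h1 : (∀ e₁ ∈ H, ∀ e₂ ∈ H, v ∈ e₁ → v ∈ e₂ → e₁.erase v ⊆ U → e₂.erase v ⊆ U → e₁ ≠ e₂ →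
    Disjoint (e₁.erase v) (e₂.erase v))
  · right
    have h2 : ¬ (∀ e₁ ∈ H, ∀ e₂ ∈ H, v ∈ e₁ → v ∈ e₂ → e₁.erase v ⊆ U → e₂.erase v ⊆ U →
        e₁ ≠ e₂ → ∀ f ∈ H, f ⊆ U → Disjoint f (e₁.erase v) ∨ Disjoint f (e₂.erase v)) :=
      fun h => hb ⟨h1, h⟩
    push Not at h2
    obtain ⟨e₁, m1, e₂, m2, v1, v2, s1, s2, hne, f, mf, hfU, d1, d2⟩ := h2
    have hd := h1 e₁ m1 e₂ m2 v1 v2 s1 s2 hne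
    have hvf : v ∉ f := fun h => hv (hfU h)
    have aux : ∀ e₁ ∈ H, ∀ e₂ ∈ H, v ∈ e₁ → v ∈ e₂ → e₁.erase v ⊆ U → e₂.erase v ⊆ U →
        ¬ Disjoint f (e₁.erase v) → ¬ Disjoint f (e₂.erase v) → ¬ e₂ ⊆ e₁ ∪ f →
        (∃ e₁ ∈ H, ∃ f ∈ H, ∃ e₂ ∈ H, v ∈ e₁ ∧ (1 ≤ (f ∩ e₁).card ∧ (f ∩ e₁).card ≤ r) ∧
        (2 ≤ (e₂ ∩ (e₁ ∪ f)).card ∧ (e₂ ∩ (e₁ ∪ f)).card ≤ r) ∧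
        (e₁ ∪ f ∪ e₂).erase v ⊆ U) := by
      intro e₁ m1 e₂ m2 v1 v2 s1 s2 d1 d2 hns
      obtain ⟨a, ha1, ha2⟩ := not_disjoint_iff.1 d1
      obtain ⟨b, hb1, hb2⟩ := not_disjoint_iff.1 d2
      rw [mem_erase] at ha2 hb2
      refine ⟨e₁, m1, f, mf, e₂, m2, v1, ⟨?_, ?_⟩, ⟨?_, ?_⟩, ?_⟩
      · exact card_pos.2 ⟨a, mem_inter.2 ⟨ha1, ha2.2⟩⟩
      · have : (f ∩ e₁) ⊂ e₁ := by
          refine ⟨inter_subset_right, fun h => hvf (mem_inter.1 (h v1)).1⟩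
        have := card_lt_card this
        rw [hu e₁ m1] at this; omega
      · have : ({b, v} : Finset V) ⊆ e₂ ∩ (e₁ ∪ f) := by
          intro z hz
          rw [mem_insert, mem_singleton] at hz
          rcases hz with rfl | rfl
          · exact mem_inter.2 ⟨hb2.2, mem_union_right _ hb1⟩
          · exact mem_inter.2 ⟨v2, mem_union_left _ v1⟩
        have h := card_le_card this
        rwa [card_pair hb2.1] at h
      · have : (e₂ ∩ (e₁ ∪ f)) ⊂ e₂ :=
          ⟨inter_subset_left, fun h => hns fun z hz => (mem_inter.1 (h hz)).2⟩
        have := card_lt_card this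
        rw [hu e₂ m2] at this; omega
      · intro z hz
        rw [mem_erase, mem_union, mem_union] at hz
        rcases hz with ⟨hz, (h | h) | h⟩
        · exact s1 (mem_erase.2 ⟨hz, h⟩)
        · exact hfU h
        · exact s2 (mem_erase.2 ⟨hz, h⟩)
    by_cases c1 : e₂ ⊆ e₁ ∪ f
    · by_cases c2 : e₁ ⊆ e₂ ∪ f
      · exfalso
        have i1 : e₂.erase v ⊆ f := by
          intro z hz
          have hz' := mem_erase.1 hz
          refine (mem_union.1 (c1 hz'.2)).resolve_left fun h => ?_
          exact disjoint_left.1 hd (mem_erase.2 ⟨hz'.1, h⟩) hz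
        have i2 : e₁.erase v ⊆ f := by
          intro z hz
          have hz' := mem_erase.1 hz
          refine (mem_union.1 (c2 hz'.2)).resolve_left fun h => ?_
          exact disjoint_left.1 hd hz (mem_erase.2 ⟨hz'.1, h⟩)
        have := card_le_card (union_subset i2 i1)
        rw [card_union_of_disjoint hd, card_erase_of_mem v1, card_erase_of_mem v2, hu _ m1,
          hu _ m2, hu _ mf] at this
        omega
      · exact aux e₂ m2 e₁ m1 v2 v1 s2 s1 d2 d1 c2
    · exact aux e₁ m1 e₂ m2 v1 v2 s1 s2 d1 d2 c1
  · left
    push Not at h1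
    obtain ⟨e₁, m1, e₂, m2, v1, v2, s1, s2, hne, d⟩ := h1
    obtain ⟨a, ha1, ha2⟩ := not_disjoint_iff.1 d
    rw [mem_erase] at ha1 ha2
    refine ⟨e₁, m1, e₂, m2, v1, ⟨?_, ?_⟩, ?_⟩
    · have : ({a, v} : Finset V) ⊆ e₂ ∩ e₁ := by
        intro z hz
        rw [mem_insert, mem_singleton] at hz
        rcases hz with rfl | rfl
        · exact mem_inter.2 ⟨ha2.2, ha1.2⟩
        · exact mem_inter.2 ⟨v2, v1⟩
      have h := card_le_card this
      rwa [card_pair ha1.1] at h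
    · have : (e₂ ∩ e₁) ⊂ e₂ := by
        refine ⟨inter_subset_left, fun h => hne ?_⟩
        have hs : e₂ ⊆ e₁ := fun z hz => (mem_inter.1 (h hz)).2
        exact (eq_of_subset_of_card_le hs (by rw [hu _ m1, hu _ m2])).symm
      have := card_lt_card this
      rw [hu e₂ m2] at this; omega
    · intro z hz
      rw [mem_erase, mem_union] at hz
      rcases hz with ⟨hz, h | h⟩
      · exact s1 (mem_erase.2 ⟨hz, h⟩)
      · exact s2 (mem_erase.2 ⟨hz, h⟩)

open Classical in
theorem kmv_bad {V : Type} [Fintype V] [DecidableEq V] (H : Finset (Finset V)) (r Δ : ℕ)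
    (hr : 2 ≤ r) (hu : ∀ e ∈ H, e.card = r + 1)
    (hΔ : ∀ R : Finset V, R.card = r → (H.filter fun e => R ⊆ e).card ≤ Δ)
    (p m τ : ℝ) (hp : 0 ≤ p) (hp1 : p ≤ 1) (hm : 1 ≤ m) (hpm : p * Fintype.card V = m)
    (hτ0 : 0 ≤ τ) (hτ : τ * Fintype.card V = Δ) (v : V) :
    ∑ U ∈ (univ.erase v).powerset, (if KMVGood H v U then 0 else
      p ^ U.card * (1 - p) ^ ((univ.erase v).card - U.card)) ≤
      2 ^ (4 * r + 4) * (m ^ (2 * r - 1) * τ ^ 2 + m ^ (3 * r - 1) * τ ^ 3) := by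
  set S := (univ : Finset V).erase v with hS
  set w : Finset V → ℝ := fun U => p ^ U.card * (1 - p) ^ (S.card - U.card) with hw
  have hw0 : ∀ U, 0 ≤ w U := fun U => by
    have : 0 ≤ 1 - p := by linarith
    simp only [hw]; positivity
  set A := H.filter fun e => 1 ≤ (e ∩ {v}).card ∧ (e ∩ {v}).card ≤ r with hA
  set B : Finset V → Finset (Finset V) := fun X =>
    H.filter fun e => 2 ≤ (e ∩ X).card ∧ (e ∩ X).card ≤ r with hB
  set C : Finset V → Finset (Finset V) := fun X =>
    H.filter fun e => 1 ≤ (e ∩ X).card ∧ (e ∩ X).card ≤ r with hC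
  have memA : ∀ e, e ∈ A ↔ e ∈ H ∧ v ∈ e := by
    intro e
    rw [hA, mem_filter]
    constructor
    · rintro ⟨h, h1, -⟩
      obtain ⟨z, hz⟩ := card_pos.1 h1
      rw [mem_inter, mem_singleton] at hz
      exact ⟨h, hz.2 ▸ hz.1⟩
    · rintro ⟨h, h1⟩
      have : e ∩ {v} = {v} := inter_eq_right.2 (singleton_subset_iff.2 h1)
      rw [this, card_singleton]
      exact ⟨h, le_rfl, by omega⟩
  have point : ∀ U ∈ S.powerset, (if KMVGood H v U then 0 else w U) ≤
      (∑ e₁ ∈ A, ∑ e₂ ∈ B e₁, if (e₁ ∪ e₂).erase v ⊆ U then w U else 0) +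
      (∑ e₁ ∈ A, ∑ f ∈ C e₁, ∑ e₂ ∈ B (e₁ ∪ f),
        if (e₁ ∪ f ∪ e₂).erase v ⊆ U then w U else 0) := by
    intro U hU
    have hvU : v ∉ U := fun h => by
      have := (mem_powerset.1 hU) h
      simp [hS] at this
    have ite0 : ∀ (P : Prop) [Decidable P], 0 ≤ (if P then w U else 0) := by
      intro P _; split_ifs
      · exact hw0 U
      · exact le_rfl
    have n1 : 0 ≤ (∑ e₁ ∈ A, ∑ e₂ ∈ B e₁, if (e₁ ∪ e₂).erase v ⊆ U then w U else 0) :=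
      sum_nonneg fun _ _ => sum_nonneg fun _ _ => ite0 _
    have n2 : 0 ≤ (∑ e₁ ∈ A, ∑ f ∈ C e₁, ∑ e₂ ∈ B (e₁ ∪ f),
        if (e₁ ∪ f ∪ e₂).erase v ⊆ U then w U else 0) :=
      sum_nonneg fun _ _ => sum_nonneg fun _ _ => sum_nonneg fun _ _ => ite0 _
    by_cases hg : KMVGood H v U
    · rw [if_pos hg]; linarith
    rw [if_neg hg]
    rcases kmv_notGood H r hr hu v U hvU hg with h | h
    · obtain ⟨e₁, m1, e₂, m2, v1, hc, hs⟩ := h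
      have a1 := single_le_sum (s := A)
        (f := fun e₁ => ∑ e₂ ∈ B e₁, if (e₁ ∪ e₂).erase v ⊆ U then w U else 0)
        (fun _ _ => sum_nonneg fun _ _ => ite0 _) ((memA e₁).2 ⟨m1, v1⟩)
      have a2 := single_le_sum (s := B e₁)
        (f := fun e₂ => if (e₁ ∪ e₂).erase v ⊆ U then w U else 0)
        (fun _ _ => ite0 _) (mem_filter.2 ⟨m2, hc⟩)
      simp only [if_pos hs] at a1 a2
      linarith
    · obtain ⟨e₁, m1, f, mf, e₂, m2, v1, hc1, hc2, hs⟩ := h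
      have a1 := single_le_sum (s := A)
        (f := fun e₁ => ∑ f ∈ C e₁, ∑ e₂ ∈ B (e₁ ∪ f),
          if (e₁ ∪ f ∪ e₂).erase v ⊆ U then w U else 0)
        (fun _ _ => sum_nonneg fun _ _ => sum_nonneg fun _ _ => ite0 _)
        ((memA e₁).2 ⟨m1, v1⟩)
      have a2 := single_le_sum (s := C e₁)
        (f := fun f => ∑ e₂ ∈ B (e₁ ∪ f), if (e₁ ∪ f ∪ e₂).erase v ⊆ U then w U else 0)
        (fun _ _ => sum_nonneg fun _ _ => ite0 _) (mem_filter.2 ⟨mf, hc1⟩)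
      have a3 := single_le_sum (s := B (e₁ ∪ f))
        (f := fun e₂ => if (e₁ ∪ f ∪ e₂).erase v ⊆ U then w U else 0)
        (fun _ _ => ite0 _) (mem_filter.2 ⟨m2, hc2⟩)
      simp only [if_pos hs] at a1 a2 a3
      linarith
  have prob : ∀ T : Finset V, ∑ U ∈ S.powerset, (if T.erase v ⊆ U then w U else 0)
      = p ^ (T.erase v).card := by
    intro T
    exact kmv_prob S (T.erase v) (erase_subset_erase _ (subset_univ _)) p
  have ext := kmv_ext H r Δ hu hΔ p m τ hp hm hpm hτ
  have extA : ∑ e ∈ A, p ^ (e \ {v}).card ≤ 2 ^ 1 * (m ^ r * τ) := by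
    have := ext {v} 1 1 (by simp)
    rwa [show r + 1 - 1 = r by omega] at this
  have hm0 : 0 ≤ m := by linarith
  have sum1 : ∑ e₁ ∈ A, ∑ e₂ ∈ B e₁, p ^ ((e₁ ∪ e₂).erase v).card ≤
      2 ^ (4 * r + 4) * (m ^ (2 * r - 1) * τ ^ 2) := by
    calc _ = ∑ e₁ ∈ A, p ^ (e₁ \ {v}).card * ∑ e₂ ∈ B e₁, p ^ (e₂ \ e₁).card := by
          apply sum_congr rfl
          intro e₁ he₁
          rw [mul_sum]
          apply sum_congr rfl
          intro e₂ _
          rw [← pow_add]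
          congr 1
          have hv1 := ((memA e₁).1 he₁).2
          rw [← card_union_of_disjoint]
          · congr 1
            ext z; simp only [mem_erase, mem_union, mem_sdiff, mem_singleton]
            by_cases hz : z = v
            · subst hz; simp [hv1]
            · tauto
          · rw [disjoint_left]; intro z; simp only [mem_sdiff]; tauto
      _ ≤ ∑ e₁ ∈ A, p ^ (e₁ \ {v}).card * (2 ^ (r + 1) * (m ^ (r - 1) * τ)) := by
          apply sum_le_sum
          intro e₁ he₁
          apply mul_le_mul_of_nonneg_left _ (by positivity)
          have := ext e₁ 2 (r + 1) (hu _ ((memA e₁).1 he₁).1).le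
          rwa [show r + 1 - 2 = r - 1 by omega] at this
      _ ≤ (2 ^ 1 * (m ^ r * τ)) * (2 ^ (r + 1) * (m ^ (r - 1) * τ)) := by
          rw [← sum_mul]
          exact mul_le_mul_of_nonneg_right extA (by positivity)
      _ = 2 ^ (r + 2) * (m ^ (2 * r - 1) * τ ^ 2) := by
          rw [show 2 * r - 1 = r + (r - 1) by omega, pow_add m]; ring
      _ ≤ _ := by
          apply mul_le_mul_of_nonneg_right _ (by positivity)
          exact pow_le_pow_right₀ (by norm_num) (by omega)
  have sum2 : ∑ e₁ ∈ A, ∑ f ∈ C e₁, ∑ e₂ ∈ B (e₁ ∪ f), p ^ ((e₁ ∪ f ∪ e₂).erase v).card ≤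
      2 ^ (4 * r + 4) * (m ^ (3 * r - 1) * τ ^ 3) := by
    calc _ = ∑ e₁ ∈ A, p ^ (e₁ \ {v}).card * ∑ f ∈ C e₁, p ^ (f \ e₁).card *
            ∑ e₂ ∈ B (e₁ ∪ f), p ^ (e₂ \ (e₁ ∪ f)).card := by
          apply sum_congr rfl
          intro e₁ he₁
          rw [mul_sum]
          apply sum_congr rfl
          intro f _
          rw [mul_sum, mul_sum]
          apply sum_congr rfl
          intro e₂ _
          rw [← pow_add, ← pow_add]
          congr 1
          have hv1 := ((memA e₁).1 he₁).2
          rw [← card_union_of_disjoint, ← card_union_of_disjoint]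
          · congr 1
            ext z; simp only [mem_erase, mem_union, mem_sdiff, mem_singleton]
            by_cases hz : z = v
            · subst hz; simp [hv1]
            · tauto
          · rw [disjoint_left]; intro z; simp only [mem_sdiff, mem_union]; tauto
          · rw [disjoint_left]; intro z; simp only [mem_sdiff, mem_union]; tauto
      _ ≤ ∑ e₁ ∈ A, p ^ (e₁ \ {v}).card * ∑ f ∈ C e₁, p ^ (f \ e₁).card *
            (2 ^ (2 * r + 2) * (m ^ (r - 1) * τ)) := by
          apply sum_le_sum
          intro e₁ he₁
          apply mul_le_mul_of_nonneg_left _ (by positivity)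
          apply sum_le_sum
          intro f hf
          apply mul_le_mul_of_nonneg_left _ (by positivity)
          have hc : (e₁ ∪ f).card ≤ 2 * r + 2 := by
            have h := card_union_le e₁ f
            rw [hu _ ((memA e₁).1 he₁).1, hu _ (mem_filter.1 hf).1] at h
            omega
          have := ext (e₁ ∪ f) 2 (2 * r + 2) hc
          rwa [show r + 1 - 2 = r - 1 by omega] at this
      _ ≤ ∑ e₁ ∈ A, p ^ (e₁ \ {v}).card * ((2 ^ (r + 1) * (m ^ r * τ)) *
            (2 ^ (2 * r + 2) * (m ^ (r - 1) * τ))) := by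
          apply sum_le_sum
          intro e₁ he₁
          apply mul_le_mul_of_nonneg_left _ (by positivity)
          rw [← sum_mul]
          apply mul_le_mul_of_nonneg_right _ (by positivity)
          have := ext e₁ 1 (r + 1) (hu _ ((memA e₁).1 he₁).1).le
          rwa [show r + 1 - 1 = r by omega] at this
      _ ≤ (2 ^ 1 * (m ^ r * τ)) * ((2 ^ (r + 1) * (m ^ r * τ)) *
            (2 ^ (2 * r + 2) * (m ^ (r - 1) * τ))) := by
          rw [← sum_mul]
          exact mul_le_mul_of_nonneg_right extA (by positivity)
      _ = 2 ^ (3 * r + 4) * (m ^ (3 * r - 1) * τ ^ 3) := by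
          rw [show 3 * r - 1 = r + r + (r - 1) by omega, pow_add m, pow_add m]; ring
      _ ≤ _ := by
          apply mul_le_mul_of_nonneg_right _ (by positivity)
          exact pow_le_pow_right₀ (by norm_num) (by omega)
  refine (sum_le_sum point).trans ?_
  rw [sum_add_distrib, mul_add]
  apply add_le_add
  · rw [sum_comm]
    refine le_of_eq_of_le ?_ sum1
    apply sum_congr rfl
    intro e₁ _
    rw [sum_comm]
    exact sum_congr rfl fun e₂ _ => prob _
  · rw [sum_comm]
    refine le_of_eq_of_le ?_ sum2
    apply sum_congr rfl
    intro e₁ _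
    rw [sum_comm]
    apply sum_congr rfl
    intro f _
    rw [sum_comm]
    exact sum_congr rfl fun e₂ _ => prob _

theorem kmv_ind_of_mem {V : Type} [DecidableEq V] {H : Finset (Finset V)} {U W : Finset V}
    (h : W ∈ KMVInd H U) : ∀ e ∈ H, ¬ e ⊆ W := by
  unfold KMVInd at h
  exact (mem_filter.1 h).2

open Classical in
theorem kmv_main {V : Type} [Fintype V] [DecidableEq V] (H : Finset (Finset V)) (r Δ α : ℕ)
    (hr : 2 ≤ r) (hu : ∀ e ∈ H, e.card = r + 1)
    (hΔ : ∀ R : Finset V, R.card = r → (H.filter fun e => R ⊆ e).card ≤ Δ)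
    (hα : ∀ W : Finset V, (∀ e ∈ H, ¬ e ⊆ W) → W.card ≤ α)
    (p m τ t : ℝ) (hp : 0 < p) (hp1 : p ≤ 1 / 2) (hm : 1 ≤ m) (hpm : p * Fintype.card V = m)
    (hτ0 : 0 ≤ τ) (hτ : τ * Fintype.card V = Δ) (ht : 0 < t) (hpt : 1 ≤ p * t)
    (hbad : 2 ^ (4 * r + 4) * (m ^ (2 * r - 1) * τ ^ 2 + m ^ (3 * r - 1) * τ ^ 3) ≤ 1 / 2) :
    Fintype.card V * (Real.log (p * t) / 8) ≤ t * α + Δ * (α : ℝ) ^ r := by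
  have hne' : ∀ e ∈ H, e.Nonempty := fun e he => card_pos.1 (by rw [hu e he]; omega)
  have hne : ∀ e ∈ H, ∀ v, v ∈ e → (e.erase v).Nonempty := fun e he v hv =>
    card_pos.1 (by rw [card_erase_of_mem hv, hu e he]; omega)
  set n := Fintype.card V with hn
  set μ : Finset V → ℝ := fun U => p ^ U.card * (1 - p) ^ (n - U.card) with hμ
  have hp' : 0 ≤ 1 - p := by linarith
  have hμ0 : ∀ U, 0 ≤ μ U := fun U => by simp only [hμ]; positivity
  have hμ1 : ∑ U ∈ (univ : Finset V).powerset, μ U = 1 := by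
    have := Finset.sum_pow_mul_eq_add_pow p (1 - p) (univ : Finset V)
    simpa [hμ, hn] using this
  have hlog : 0 ≤ Real.log (p * t) := Real.log_nonneg hpt
  -- upper bound
  have upper : ∀ U, ∑ v, KMVF H t v U ≤ t * α + Δ * (α : ℝ) ^ r := by
    intro U
    have hpos : (0:ℝ) < (KMVInd H U).card := by
      exact_mod_cast card_pos.2 ⟨∅, kmv_empty_mem H U hne'⟩
    unfold KMVF
    rw [← sum_div, div_le_iff₀ hpos, sum_comm]
    calc _ ≤ ∑ W ∈ KMVInd H U, (t * α + Δ * (α : ℝ) ^ r) := by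
          apply sum_le_sum
          intro W hW
          rw [sum_add_distrib, ← mul_sum]
          have hc : W.card ≤ α := hα W (kmv_ind_of_mem hW)
          have hc' : (W.card : ℝ) ≤ α := by exact_mod_cast hc
          apply add_le_add
          · apply mul_le_mul_of_nonneg_left _ ht.le
            rw [sum_boole]
            simpa using hc
          · have h1 := kmv_sum_D H r Δ hu hΔ W
            have h2 : ∑ v, (KMVD H v W : ℝ) ≤ Δ * (W.card : ℝ) ^ r := by exact_mod_cast h1
            refine h2.trans ?_
            apply mul_le_mul_of_nonneg_left _ (Nat.cast_nonneg _)
            exact pow_le_pow_left₀ (Nat.cast_nonneg _) hc' r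
      _ = _ := by rw [sum_const, nsmul_eq_mul]; ring
  -- lower bound
  have lower : ∀ v : V, Real.log (p * t) / 8 ≤
      ∑ U ∈ (univ : Finset V).powerset, μ U * KMVF H t v U := by
    intro v
    set S := (univ : Finset V).erase v with hS
    have hvS : v ∉ S := by simp [hS]
    have hins : insert v S = univ := insert_erase (mem_univ v)
    have hScard : S.card + 1 = n := by
      rw [hS, card_erase_of_mem (mem_univ v), card_univ]
      have : 0 < Fintype.card V := Fintype.card_pos_iff.2 ⟨v⟩
      omega
    rw [← hins, sum_powerset_insert hvS, ← sum_add_distrib]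
    set w : Finset V → ℝ := fun U => p ^ U.card * (1 - p) ^ (S.card - U.card) with hw
    have hw0 : ∀ U, 0 ≤ w U := fun U => by simp only [hw]; positivity
    have hw1 : ∑ U ∈ S.powerset, w U = 1 := by
      have := Finset.sum_pow_mul_eq_add_pow p (1 - p) S
      simpa [hw] using this
    have hb := kmv_bad H r Δ hr hu hΔ p m τ hp.le (by linarith) hm hpm hτ0 hτ v
    have hb2 := hb.trans hbad
    have step : ∀ U ∈ S.powerset, Real.log (p * t) / 4 * (w U - (if KMVGood H v U then 0 else w U))
        ≤ μ U * KMVF H t v U + μ (insert v U) * KMVF H t v (insert v U) := by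
      intro U hU
      rw [mem_powerset] at hU
      have hvU : v ∉ U := fun h => hvS (hU h)
      have hc := card_le_card hU
      have e1 : μ U = w U * (1 - p) := by
        simp only [hμ, hw]
        rw [show n - U.card = (S.card - U.card) + 1 by omega, pow_succ]; ring
      have e2 : μ (insert v U) = w U * p := by
        simp only [hμ, hw]
        rw [card_insert_of_notMem hvU, show n - (U.card + 1) = S.card - U.card by omega, pow_succ]
        ring
      by_cases hg : KMVGood H v U
      · rw [if_pos hg, e1, e2]
        have := kmv_local2 H v U hvU (fun e he hv => hne e he v hv) hne' hg p t hp hp1 ht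
        have := mul_le_mul_of_nonneg_left this (hw0 U)
        linarith
      · rw [if_neg hg, sub_self, mul_zero]
        exact add_nonneg (mul_nonneg (hμ0 _) (kmvF_nonneg H t ht.le v _))
          (mul_nonneg (hμ0 _) (kmvF_nonneg H t ht.le v _))
    refine le_trans ?_ (sum_le_sum step)
    rw [← mul_sum, sum_sub_distrib, hw1]
    have : Real.log (p * t) / 8 = Real.log (p * t) / 4 * (1 - 1 / 2) := by ring
    rw [this]
    apply mul_le_mul_of_nonneg_left _ (by linarith)
    linarith
  calc (n : ℝ) * (Real.log (p * t) / 8) = ∑ v : V, Real.log (p * t) / 8 := by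
        rw [sum_const, nsmul_eq_mul, card_univ]
    _ ≤ ∑ v : V, ∑ U ∈ (univ : Finset V).powerset, μ U * KMVF H t v U :=
        sum_le_sum fun v _ => lower v
    _ = ∑ U ∈ (univ : Finset V).powerset, μ U * ∑ v : V, KMVF H t v U := by
        rw [sum_comm]
        exact sum_congr rfl fun U _ => (mul_sum _ _ _).symm
    _ ≤ ∑ U ∈ (univ : Finset V).powerset, μ U * (t * α + Δ * (α : ℝ) ^ r) :=
        sum_le_sum fun U _ => mul_le_mul_of_nonneg_left (upper U) (hμ0 U)
    _ = _ := by rw [← sum_mul, hμ1, one_mul]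

theorem kmv_params (r : ℕ) (hr : 2 ≤ r) : ∃ K : ℝ, 1 ≤ K ∧ ∀ s : ℝ, K ≤ s →
    s ^ ((1:ℝ) / r + 1 / (6 * (r:ℝ) ^ 2)) ≤ s / 2 ∧
    (2:ℝ) ^ (4 * r + 4) * (2 * s ^ (-(1 / (2 * (r:ℝ))))) ≤ 1 / 2 ∧
    Real.log s ≤ s ^ (1 / (12 * (r:ℝ))) ∧ 1 ≤ Real.log s := by
  have hr' : (2:ℝ) ≤ r := by exact_mod_cast hr
  have hr0 : (0:ℝ) < r := by linarith
  have E1 : ∀ᶠ s : ℝ in Filter.atTop, s ^ ((1:ℝ) / r + 1 / (6 * (r:ℝ) ^ 2)) ≤ s / 2 := by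
    have ha : 0 < 1 - ((1:ℝ) / r + 1 / (6 * (r:ℝ) ^ 2)) := by
      have h1 : (1:ℝ) / r ≤ 1 / 2 := one_div_le_one_div_of_le (by norm_num) hr'
      have h2 : 1 / (6 * (r:ℝ) ^ 2) ≤ 1 / 4 := by
        apply one_div_le_one_div_of_le (by norm_num); nlinarith
      linarith
    filter_upwards [(tendsto_rpow_atTop ha).eventually_ge_atTop 2, Filter.eventually_gt_atTop 0]
      with s h1 h2
    rw [Real.rpow_sub h2, Real.rpow_one, le_div_iff₀ (by positivity)] at h1
    linarith
  have E2 : ∀ᶠ s : ℝ in Filter.atTop,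
      (2:ℝ) ^ (4 * r + 4) * (2 * s ^ (-(1 / (2 * (r:ℝ))))) ≤ 1 / 2 := by
    have h := (tendsto_rpow_neg_atTop (y := 1 / (2 * (r:ℝ))) (by positivity))
    have h2 := (h.const_mul 2).const_mul ((2:ℝ) ^ (4 * r + 4))
    simp only [mul_zero] at h2
    exact h2.eventually_le_const (by norm_num)
  have E3 : ∀ᶠ s : ℝ in Filter.atTop, Real.log s ≤ s ^ (1 / (12 * (r:ℝ))) := by
    have := (isLittleO_log_rpow_atTop (r := 1 / (12 * (r:ℝ))) (by positivity)).bound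
      (c := 1) one_pos
    filter_upwards [this, Filter.eventually_gt_atTop 0] with s h h2
    rw [one_mul, Real.norm_eq_abs, Real.norm_eq_abs, abs_of_pos (Real.rpow_pos_of_pos h2 _)] at h
    exact (le_abs_self _).trans h
  have E4 : ∀ᶠ s : ℝ in Filter.atTop, 1 ≤ Real.log s :=
    Real.tendsto_log_atTop.eventually_ge_atTop 1
  obtain ⟨K, hK⟩ := Filter.eventually_atTop.1 (E1.and (E2.and (E3.and E4)))
  exact ⟨max K 1, le_max_right _ _, fun s hs => hK s ((le_max_left _ _).trans hs)⟩

theorem kmv_large (r : ℕ) (hr : 2 ≤ r) {V : Type} [Fintype V] [DecidableEq V]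
    (H : Finset (Finset V)) (Δ α : ℕ) (hu : ∀ e ∈ H, e.card = r + 1)
    (hΔ : ∀ R : Finset V, R.card = r → (H.filter fun e => R ⊆ e).card ≤ Δ)
    (hα : ∀ W : Finset V, (∀ e ∈ H, ¬ e ⊆ W) → W.card ≤ α) (hΔ1 : 1 ≤ Δ)
    (s : ℝ) (hs : s = (Fintype.card V : ℝ) / Δ) (hs1 : 1 ≤ s)
    (h1 : s ^ ((1:ℝ) / r + 1 / (6 * (r:ℝ) ^ 2)) ≤ s / 2)
    (h2 : (2:ℝ) ^ (4 * r + 4) * (2 * s ^ (-(1 / (2 * (r:ℝ))))) ≤ 1 / 2)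
    (h3 : Real.log s ≤ s ^ (1 / (12 * (r:ℝ)))) (h4 : 1 ≤ Real.log s)
    (c : ℝ) (hc0 : 0 < c) (hc : c ≤ 1 / (192 * (r:ℝ) ^ 2)) :
    c * (s * Real.log s) ^ ((1:ℝ) / r) ≤ α := by
  have hr' : (2:ℝ) ≤ r := by exact_mod_cast hr
  have hr0 : (0:ℝ) < r := by linarith
  have hs0 : 0 < s := by linarith
  have hD : (1:ℝ) ≤ Δ := by exact_mod_cast hΔ1
  have hn : (Fintype.card V : ℝ) = s * Δ := by rw [hs]; field_simp
  have hsn : s ≤ Fintype.card V := by rw [hn]; nlinarith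
  have hn0 : (0:ℝ) < Fintype.card V := by linarith
  set n : ℝ := (Fintype.card V : ℝ) with hndef
  set a : ℝ := (1:ℝ) / r + 1 / (6 * (r:ℝ) ^ 2) with ha
  set m : ℝ := s ^ a with hm
  set A : ℝ := (s * Real.log s) ^ ((1:ℝ) / r) with hA
  have hlog0 : 0 < Real.log s := by linarith
  have hA0 : 0 < A := Real.rpow_pos_of_pos (by positivity) _
  have ha0 : 0 < a := by positivity
  have hm1 : 1 ≤ m := Real.one_le_rpow hs1 ha0.le
  have hm0 : 0 < m := by linarith
  have hAr : A ^ r = s * Real.log s := by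
    rw [hA, ← Real.rpow_natCast, ← Real.rpow_mul (by positivity), one_div,
      inv_mul_cancel₀ hr0.ne', Real.rpow_one]
  have hpt : s ^ (1 / (12 * (r:ℝ) ^ 2)) ≤ m / n * (n / A) := by
    have e : m / n * (n / A) = m / A := by field_simp
    rw [e, le_div_iff₀ hA0, hA, Real.mul_rpow hs0.le hlog0.le]
    have : Real.log s ^ ((1:ℝ) / r) ≤ s ^ (1 / (12 * (r:ℝ) ^ 2)) := by
      calc _ ≤ (s ^ (1 / (12 * (r:ℝ)))) ^ ((1:ℝ) / r) :=
            Real.rpow_le_rpow hlog0.le h3 (by positivity)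
        _ = _ := by
            rw [← Real.rpow_mul hs0.le]; congr 1; field_simp
    calc _ ≤ s ^ (1 / (12 * (r:ℝ) ^ 2)) * (s ^ ((1:ℝ) / r) * s ^ (1 / (12 * (r:ℝ) ^ 2))) := by
          gcongr
      _ = m := by
          rw [← Real.rpow_add hs0, ← Real.rpow_add hs0, hm, ha]; congr 1; field_simp; ring
  have hbig1 : 1 ≤ s ^ (1 / (12 * (r:ℝ) ^ 2)) := Real.one_le_rpow hs1 (by positivity)
  have hlogpt : 1 / (12 * (r:ℝ) ^ 2) * Real.log s ≤ Real.log (m / n * (n / A)) := by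
    rw [← Real.log_rpow hs0]
    exact Real.log_le_log (by linarith) hpt
  have hb1 : m ^ (2 * r - 1) * (1 / s) ^ 2 ≤ s ^ (-(1 / (2 * (r:ℝ)))) := by
    have e : m ^ (2 * r - 1) * (1 / s) ^ 2 = s ^ (a * (2 * r - 1) - 2) := by
      rw [Real.rpow_sub hs0, hm, Real.rpow_mul hs0.le]
      have : (2 * (r:ℝ) - 1) = ((2 * r - 1 : ℕ) : ℝ) := by
        rw [Nat.cast_sub (by omega)]; push_cast; ring
      rw [this, Real.rpow_natCast, show (2:ℝ) = ((2:ℕ):ℝ) by norm_num, Real.rpow_natCast]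
      field_simp
    rw [e]
    apply Real.rpow_le_rpow_of_exponent_le hs1
    have : a * (2 * r - 1) - 2 + 1 / (2 * (r:ℝ)) = -((r + 1) / (6 * (r:ℝ) ^ 2)) := by
      rw [ha]; field_simp; ring
    have : 0 ≤ (r + 1) / (6 * (r:ℝ) ^ 2) := by positivity
    linarith
  have hb2 : m ^ (3 * r - 1) * (1 / s) ^ 3 ≤ s ^ (-(1 / (2 * (r:ℝ)))) := by
    have e : m ^ (3 * r - 1) * (1 / s) ^ 3 = s ^ (a * (3 * r - 1) - 3) := by
      rw [Real.rpow_sub hs0, hm, Real.rpow_mul hs0.le]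
      have : (3 * (r:ℝ) - 1) = ((3 * r - 1 : ℕ) : ℝ) := by
        rw [Nat.cast_sub (by omega)]; push_cast; ring
      rw [this, Real.rpow_natCast, show (3:ℝ) = ((3:ℕ):ℝ) by norm_num, Real.rpow_natCast]
      field_simp
    rw [e]
    apply Real.rpow_le_rpow_of_exponent_le hs1
    have : a * (3 * r - 1) - 3 + 1 / (2 * (r:ℝ)) = -(1 / (6 * (r:ℝ) ^ 2)) := by
      rw [ha]; field_simp; ring
    have : 0 ≤ 1 / (6 * (r:ℝ) ^ 2) := by positivity
    linarith
  have main := kmv_main H r Δ α hr hu hΔ hα (m / n) m (1 / s) (n / A) (by positivity)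
    (by rw [div_le_iff₀ hn0]; linarith) hm1 (by rw [← hndef]; field_simp) (by positivity)
    (by rw [← hndef, hn]; field_simp) (by positivity) (by linarith)
    (by
      refine le_trans ?_ h2
      apply mul_le_mul_of_nonneg_left _ (by positivity)
      linarith)
  rw [← hndef] at main
  by_contra hcon
  push Not at hcon
  have hα0 : (0:ℝ) ≤ α := Nat.cast_nonneg _
  have hc1 : c ≤ 1 := hc.trans (by
    rw [div_le_one (by positivity)]
    have : (1:ℝ) ≤ (r:ℝ) ^ 2 := one_le_pow₀ (by linarith)
    linarith)
  have u2 : Δ * (α : ℝ) ^ r ≤ n * c * Real.log s := by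
    calc Δ * (α : ℝ) ^ r ≤ Δ * (c * A) ^ r := by gcongr
      _ = c ^ r * (n * Real.log s) := by rw [mul_pow, hAr, hn]; ring
      _ ≤ c * (n * Real.log s) := by
          apply mul_le_mul_of_nonneg_right _ (by positivity)
          exact pow_le_of_le_one hc0.le hc1 (by omega)
      _ = _ := by ring
  have u1' : n / A * α < n * c := by
    rw [div_mul_eq_mul_div, div_lt_iff₀ hA0, mul_assoc]
    exact mul_lt_mul_of_pos_left hcon hn0
  have l1 : n * (1 / (96 * (r:ℝ) ^ 2) * Real.log s) ≤
      n * (Real.log (m / n * (n / A)) / 8) := by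
    apply mul_le_mul_of_nonneg_left _ hn0.le
    have : 1 / (96 * (r:ℝ) ^ 2) * Real.log s = 1 / (12 * (r:ℝ) ^ 2) * Real.log s / 8 := by
      field_simp; norm_num
    linarith
  have l2 : n * (2 * c * Real.log s) ≤ n * (1 / (96 * (r:ℝ) ^ 2) * Real.log s) := by
    apply mul_le_mul_of_nonneg_left _ hn0.le
    apply mul_le_mul_of_nonneg_right _ hlog0.le
    have : 1 / (96 * (r:ℝ) ^ 2) = 2 * (1 / (192 * (r:ℝ) ^ 2)) := by field_simp; norm_num
    linarith
  have l3 : n * c * 1 ≤ n * c * Real.log s := mul_le_mul_of_nonneg_left h4 (by positivity)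
  linarith

/-- Kostochka–Mubayi–Verstraëte: for each `r ≥ 2` there is a
constant `c_r > 0` such that every `(r+1)`-uniform hypergraph `H` on `n` vertices whose
maximum `r`-degree `Δ_r` satisfies `1 ≤ Δ_r < n / (log n)^{3r²}` has independence
number at least `c_r · ((n/Δ_r) · log(n/Δ_r))^{1/r}`. -/
theorem hypergraph_independence_number_bound (r : ℕ) (hr : 2 ≤ r) :
    ∃ c : ℝ, 0 < c ∧
      ∀ (V : Type) [Fintype V] [DecidableEq V] (H : Finset (Finset V)),
        (∀ e ∈ H, e.card = r + 1) →
        ∀ Δ : ℕ,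
          Δ = ((Finset.univ.filter fun R : Finset V => R.card = r).sup
            fun R => (H.filter fun e => R ⊆ e).card) →
          1 ≤ Δ →
          (Δ : ℝ) < (Fintype.card V : ℝ) / (Real.log (Fintype.card V)) ^ (3 * r ^ 2) →
          c * (((Fintype.card V : ℝ) / Δ) * Real.log ((Fintype.card V : ℝ) / Δ)) ^ ((1 : ℝ) / r) ≤
            (((Finset.univ.filter fun S : Finset V => ∀ e ∈ H, ¬ e ⊆ S).sup Finset.card : ℕ) : ℝ) := by
  obtain ⟨K, hK1, hK⟩ := kmv_params r hr
  have hr' : (2:ℝ) ≤ r := by exact_mod_cast hr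
  have hr0 : (0:ℝ) < r := by linarith
  set B : ℝ := (K * Real.log K) ^ ((1:ℝ) / r) with hB
  have hlogK : 0 ≤ Real.log K := Real.log_nonneg hK1
  have hB0 : 0 ≤ B := Real.rpow_nonneg (by positivity) _
  refine ⟨min (1 / (192 * (r:ℝ) ^ 2)) (1 / (B + 1)), by positivity, ?_⟩
  intro V _ _ H hu Δ hΔ hΔ1 hlt
  set α := (Finset.univ.filter fun S : Finset V => ∀ e ∈ H, ¬ e ⊆ S).sup Finset.card with hαdef
  have hα : ∀ W : Finset V, (∀ e ∈ H, ¬ e ⊆ W) → W.card ≤ α := by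
    intro W hW
    exact Finset.le_sup (f := Finset.card) (mem_filter.2 ⟨mem_univ _, hW⟩)
  have hdeg : ∀ R : Finset V, R.card = r → (H.filter fun e => R ⊆ e).card ≤ Δ := by
    intro R hR
    rw [hΔ]
    exact Finset.le_sup (f := fun R : Finset V => (H.filter fun e => R ⊆ e).card)
      (mem_filter.2 ⟨mem_univ _, hR⟩)
  have hHne : H.Nonempty := by
    rw [nonempty_iff_ne_empty]
    rintro rfl
    rw [hΔ] at hΔ1
    simp at hΔ1
  obtain ⟨e, he⟩ := hHne
  have hn3 : 3 ≤ Fintype.card V := by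
    have := card_le_univ e
    rw [hu e he] at this
    omega
  have hn3' : (3:ℝ) ≤ Fintype.card V := by exact_mod_cast hn3
  have hlogn : 1 ≤ Real.log (Fintype.card V) := by
    rw [Real.le_log_iff_exp_le (by linarith)]
    have := Real.exp_one_lt_d9
    linarith
  have hΔn : (Δ : ℝ) < Fintype.card V :=
    hlt.trans_le (div_le_self (by linarith) (one_le_pow₀ hlogn))
  have hD : (1:ℝ) ≤ Δ := by exact_mod_cast hΔ1
  set s : ℝ := (Fintype.card V : ℝ) / Δ with hs
  have hs1 : 1 ≤ s := by
    rw [hs, le_div_iff₀ (by linarith)]; linarith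
  by_cases hsK : K ≤ s
  · obtain ⟨h1, h2, h3, h4⟩ := hK s hsK
    exact kmv_large r hr H Δ α hu hdeg hα hΔ1 s hs hs1 h1 h2 h3 h4 _ (by positivity)
      (min_le_left _ _)
  · push Not at hsK
    have hα1 : (1:ℝ) ≤ α := by
      obtain ⟨v⟩ : Nonempty V := Fintype.card_pos_iff.1 (by omega)
      have := hα {v} (by
        intro e he h
        have := card_le_card h
        rw [hu e he, card_singleton] at this
        omega)
      rw [card_singleton] at this
      exact_mod_cast this
    have hls : 0 ≤ Real.log s := Real.log_nonneg hs1
    have hAB : (s * Real.log s) ^ ((1:ℝ) / r) ≤ B := by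
      apply Real.rpow_le_rpow (by positivity) _ (by positivity)
      exact mul_le_mul hsK.le (Real.log_le_log (by linarith) hsK.le) hls (by linarith)
    calc _ ≤ 1 / (B + 1) * B :=
          mul_le_mul (min_le_right _ _) hAB (Real.rpow_nonneg (by positivity) _) (by positivity)
      _ ≤ 1 := by
          rw [one_div_mul_eq_div, div_le_one (by linarith)]; linarith
      _ ≤ α := hα1
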